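/- Let k ≥ 4. For every n ∈ ℕ, the word ξ^n(0) is a return word to itself in u_k, and every return word to ξ^n(0) in u_k has length at least |ξ^n(0)|; hence the shortest return word to ξ^n(0) in u_k is ξ^n(0) itself. -/

import Mathlib

open List Filter Topology

/-- The alphabet `A`: the letter `(b, j)` is the unprimed letter `j` if `b = false`
and the primed letter `j′` if `b = true`.  Only letters with `j < k` occur. -/
abbrev Letter : Type := Bool × ℕ

/-- The morphism ξ_k on letters: `0 ↦ 01`, `j ↦ j+1` for `1 ≤ j ≤ k−2`, `k−1 ↦ 0′`,
and symmetrically on primed letters with `(k−1)′ ↦ 0`. -/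
def xiL (k : ℕ) (a : Letter) : List Letter :=
  if a.2 = 0 then [(a.1, 0), (a.1, 1)]
  else if a.2 = k - 1 then [(!a.1, 0)]
  else [(a.1, a.2 + 1)]

/-- The morphism ξ_k on finite words. -/
def xiW (k : ℕ) (w : List Letter) : List Letter := w.flatMap (xiL k)

/-- The word ξ_k^n(0). -/
def xiPow (k n : ℕ) : List Letter := (xiW k)^[n] [((false : Bool), (0 : ℕ))]

/-- The projection π : A → {0,1}, with `false` playing the role of `0` and
`true` the role of `1`. -/
def proj (a : Letter) : Bool := if a.2 = 0 then a.1 else !a.1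

/-- The twin map `ℓ ↔ ℓ′` on letters. -/
def twin (a : Letter) : Letter := (!a.1, a.2)

/-- The finite word `w` occurs in the infinite word `v` at position `j`. -/
def OccursAt {α : Type*} (w : List α) (v : ℕ → α) (j : ℕ) : Prop :=
  ∀ i, i < w.length → w[i]? = some (v (j + i))

/-- The finite word `w` is a prefix of the infinite word `v`. -/
def PrefixSeq {α : Type*} (w : List α) (v : ℕ → α) : Prop := OccursAt w v 0

/-- The finite word `w` is a factor of the infinite word `v`. -/
def FactorOf {α : Type*} (w : List α) (v : ℕ → α) : Prop := ∃ j, OccursAt w v j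

/-- `v` is the fixed point `u_k = ξ_k^ω(0)`: every `ξ_k^n(0)` is a prefix of `v`. -/
def IsFixedPoint (k : ℕ) (v : ℕ → Letter) : Prop := ∀ n, PrefixSeq (xiPow k n) v

/-- `q ≥ 1` is a period of the finite word `z`. -/
def HasPeriod {α : Type*} (z : List α) (q : ℕ) : Prop :=
  1 ≤ q ∧ ∀ i, i + q < z.length → z[i]? = z[i + q]?

/-- `w` is a left special factor of the infinite word `v`. -/
def LeftSpecial {α : Type*} (w : List α) (v : ℕ → α) : Prop :=
  ∃ a b : α, a ≠ b ∧ FactorOf (a :: w) v ∧ FactorOf (b :: w) v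

/-- `w` is a right special factor of the infinite word `v`. -/
def RightSpecial {α : Type*} (w : List α) (v : ℕ → α) : Prop :=
  ∃ a b : α, a ≠ b ∧ FactorOf (w ++ [a]) v ∧ FactorOf (w ++ [b]) v

/-- `w` is a bispecial factor of the infinite word `v`. -/
def Bispecial {α : Type*} (w : List α) (v : ℕ → α) : Prop :=
  LeftSpecial w v ∧ RightSpecial w v

/-- The set of left extensions of `w` in `v`. -/
def Lext {α : Type*} (w : List α) (v : ℕ → α) : Set α := {a | FactorOf (a :: w) v}

/-- The set of right extensions of `w` in `v`. -/
def Rext {α : Type*} (w : List α) (v : ℕ → α) : Set α := {a | FactorOf (w ++ [a]) v}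

/-- `r` is a return word to `w` in `v`: it spans two consecutive occurrences of `w`. -/
def ReturnWordTo {α : Type*} (r w : List α) (v : ℕ → α) : Prop :=
  ∃ j ℓ, j < ℓ ∧ OccursAt w v j ∧ OccursAt w v ℓ ∧
    (∀ m, j < m → m < ℓ → ¬ OccursAt w v m) ∧
    r = (List.range (ℓ - j)).map (fun i => v (j + i))

/-- The factor complexity of an infinite word. -/
noncomputable def complexity {α : Type*} (v : ℕ → α) (n : ℕ) : ℕ :=
  {w : List α | w.length = n ∧ FactorOf w v}.ncard

/-- The first letter of the image of a letter under ξ_k. -/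
def xiHead (k : ℕ) (a : Letter) : Letter :=
  if a.2 = 0 then a else if a.2 = k - 1 then (!a.1, 0) else (a.1, a.2 + 1)

/-- The length of the image under ξ_k of the prefix of length `m` of `u`. -/
def imagePos (k : ℕ) (u : ℕ → Letter) : ℕ → ℕ
  | 0 => 0
  | m + 1 => imagePos k u m + (xiL k (u m)).length

/-- The prefix of length `M` of `u`, with the twin map applied if `t = true`,
occurs in `u` at position `q`. -/
def PrefixOccurs (u : ℕ → Letter) (t : Bool) (q M : ℕ) : Prop :=
  ∀ i, i < M → u (q + i) = (xor t (u i).1, (u i).2)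

lemma xiL_of_zero {k : ℕ} {a : Letter} (h : a.2 = 0) : xiL k a = [xiHead k a, (a.1, 1)] := by
  obtain ⟨b, j⟩ := a
  simp only at h
  simp [xiL, xiHead, h]

lemma xiL_of_ne_zero {k : ℕ} {a : Letter} (h : a.2 ≠ 0) : xiL k a = [xiHead k a] := by
  unfold xiL xiHead
  split_ifs <;> simp_all

lemma xiHead_twist (k : ℕ) (t : Bool) (a : Letter) :
    xiHead k (xor t a.1, a.2) = (xor t (xiHead k a).1, (xiHead k a).2) := by
  unfold xiHead
  split_ifs <;> simp_all

lemma xiHead_snd_ne_one (k : ℕ) (a : Letter) : (xiHead k a).2 ≠ 1 := by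
  unfold xiHead
  split_ifs <;> simp_all

lemma eq_of_xiHead_eq {k : ℕ} {a b : Letter} (h0 : a.2 = 0 ↔ b.2 = 0)
    (h : xiHead k a = xiHead k b) : a = b := by
  obtain ⟨a, i⟩ := a
  obtain ⟨b, j⟩ := b
  unfold xiHead at h
  split_ifs at h <;> simp_all

lemma occursAt_iff {α : Type*} {w : List α} {v : ℕ → α} {j : ℕ} :
    OccursAt w v j ↔ w = (List.range w.length).map (fun i => v (j + i)) := by
  constructor
  · intro h
    apply List.ext_getElem?
    intro i
    by_cases hi : i < w.length
    · rw [h i hi]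
      simp [hi]
    · simp [hi]
  · intro h i hi
    rw [h]
    simp [hi]

lemma xiPow_succ (k n : ℕ) : xiPow k (n + 1) = xiW k (xiPow k n) :=
  Function.iterate_succ_apply' _ _ _

lemma length_le_length_xiW (k : ℕ) (w : List Letter) : w.length ≤ (xiW k w).length := by
  induction w with
  | nil => simp
  | cons a w ih =>
    have : 1 ≤ (xiL k a).length := by
      unfold xiL
      split_ifs <;> simp
    simp only [xiW, List.flatMap_cons, List.length_append, List.length_cons] at ih ⊢
    omega

lemma lt_of_mem_xiPow {k : ℕ} (hk : 2 ≤ k) (n : ℕ) : ∀ a ∈ xiPow k n, a.2 < k := by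
  induction n with
  | zero =>
    intro a ha
    simp only [xiPow, Function.iterate_zero, id, List.mem_singleton] at ha
    subst ha
    simp only
    omega
  | succ n ih =>
    intro a ha
    rw [xiPow_succ, xiW, List.mem_flatMap] at ha
    obtain ⟨b, hb, hab⟩ := ha
    have := ih b hb
    unfold xiL at hab
    split_ifs at hab <;> simp only [List.mem_cons, List.not_mem_nil, or_false] at hab
    · rcases hab with rfl | rfl <;> simp only <;> omega
    · subst hab
      simp only
      omega
    · subst hab
      simp only
      omega

lemma xiPow_head (k n : ℕ) : ∃ w, xiPow k n = (false, 0) :: w := by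
  induction n with
  | zero => exact ⟨[], rfl⟩
  | succ n ih =>
    obtain ⟨w, hw⟩ := ih
    exact ⟨(false, 1) :: xiW k w, by rw [xiPow_succ, hw]; simp [xiW, xiL]⟩

lemma lt_length_xiPow (k n : ℕ) : n < (xiPow k n).length := by
  induction n with
  | zero => simp [xiPow]
  | succ n ih =>
    obtain ⟨w, hw⟩ := xiPow_head k n
    have h := length_le_length_xiW k w
    rw [xiPow_succ, hw]
    rw [hw] at ih
    simp only [xiW, List.flatMap_cons, List.length_append, List.length_cons] at ih h ⊢
    simp only [xiL, if_true, List.length_cons, List.length_nil]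
    omega

lemma length_xiW_map_range {k : ℕ} {u : ℕ → Letter} (m : ℕ) :
    (xiW k ((List.range m).map u)).length = imagePos k u m := by
  induction m with
  | zero => simp [xiW, imagePos]
  | succ m ih =>
    rw [List.range_succ, List.map_append, xiW, List.flatMap_append, List.length_append]
    rw [xiW] at ih
    simp [ih, imagePos]

namespace IsFixedPoint

variable {k : ℕ} {u : ℕ → Letter}

lemma xiPow_eq (hu : IsFixedPoint k u) (n : ℕ) :
    xiPow k n = (List.range (xiPow k n).length).map u := by
  have := occursAt_iff.1 (hu n)
  simpa using this

lemma xiW_map_range (hu : IsFixedPoint k u) (m : ℕ) :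
    xiW k ((List.range m).map u) = (List.range (imagePos k u m)).map u := by
  have hpre : (List.range m).map u <+: xiPow k m := by
    rw [hu.xiPow_eq m]
    have h := lt_length_xiPow k m
    obtain ⟨d, hd⟩ := Nat.exists_eq_add_of_le h.le
    rw [hd, List.range_add, List.map_append]
    exact List.prefix_append _ _
  have h2 : xiW k ((List.range m).map u) <+: xiPow k (m + 1) := by
    obtain ⟨s, hs⟩ := hpre
    rw [xiPow_succ, ← hs, xiW, xiW, List.flatMap_append]
    exact List.prefix_append _ _
  have hle := h2.length_le
  rw [List.prefix_iff_eq_take, length_xiW_map_range, hu.xiPow_eq (m + 1), ← List.map_take,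
    List.take_range, min_eq_left] at h2
  · exact h2
  · rwa [length_xiW_map_range] at hle

lemma length_xiPow_succ (hu : IsFixedPoint k u) (n : ℕ) :
    (xiPow k (n + 1)).length = imagePos k u (xiPow k n).length := by
  rw [← length_xiW_map_range, ← hu.xiPow_eq, xiPow_succ]

lemma xiL_eq (hu : IsFixedPoint k u) (m : ℕ) :
    xiL k (u m) = (List.range (xiL k (u m)).length).map (fun i => u (imagePos k u m + i)) := by
  have h := hu.xiW_map_range (m + 1)
  rw [List.range_succ, List.map_append, xiW, List.flatMap_append, imagePos, List.range_add,
    List.map_append] at h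
  have h' := hu.xiW_map_range m
  rw [xiW] at h'
  rw [h'] at h
  simpa [Function.comp_def] using List.append_cancel_left h

lemma apply_imagePos (hu : IsFixedPoint k u) (m : ℕ) :
    u (imagePos k u m) = xiHead k (u m) := by
  have h := hu.xiL_eq m
  by_cases h0 : (u m).2 = 0
  · rw [xiL_of_zero h0] at h
    simpa [List.range_succ, eq_comm] using congrArg List.head? h
  · rw [xiL_of_ne_zero h0] at h
    simpa [List.range_succ, eq_comm] using h

lemma apply_imagePos_add_one (hu : IsFixedPoint k u) {m : ℕ} (h0 : (u m).2 = 0) :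
    u (imagePos k u m + 1) = ((u m).1, 1) := by
  have h := hu.xiL_eq m
  rw [xiL_of_zero h0] at h
  simp only [List.length_cons, List.length_nil, List.range_succ] at h
  simp at h
  exact h.2.symm

end IsFixedPoint

lemma imagePos_succ_of_zero {k : ℕ} {u : ℕ → Letter} {m : ℕ} (h : (u m).2 = 0) :
    imagePos k u (m + 1) = imagePos k u m + 2 := by
  rw [imagePos, xiL_of_zero h]
  rfl

lemma imagePos_succ_of_ne_zero {k : ℕ} {u : ℕ → Letter} {m : ℕ} (h : (u m).2 ≠ 0) :
    imagePos k u (m + 1) = imagePos k u m + 1 := by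
  rw [imagePos, xiL_of_ne_zero h]
  rfl

lemma imagePos_strictMono (k : ℕ) (u : ℕ → Letter) : StrictMono (imagePos k u) := by
  apply strictMono_nat_of_lt_succ
  intro m
  by_cases h : (u m).2 = 0
  · rw [imagePos_succ_of_zero h]
    omega
  · rw [imagePos_succ_of_ne_zero h]
    omega

lemma exists_imagePos (k : ℕ) (u : ℕ → Letter) (q : ℕ) :
    ∃ m, q = imagePos k u m ∨ ((u m).2 = 0 ∧ q = imagePos k u m + 1) := by
  induction q with
  | zero => exact ⟨0, Or.inl rfl⟩
  | succ q ih =>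
    obtain ⟨m, rfl | ⟨h0, rfl⟩⟩ := ih
    · by_cases h : (u m).2 = 0
      · exact ⟨m, Or.inr ⟨h, rfl⟩⟩
      · exact ⟨m + 1, Or.inl (imagePos_succ_of_ne_zero h).symm⟩
    · exact ⟨m + 1, Or.inl (imagePos_succ_of_zero h0).symm⟩

namespace IsFixedPoint

variable {k : ℕ} {u : ℕ → Letter}

lemma apply_zero (hu : IsFixedPoint k u) : u 0 = (false, 0) := by
  have := hu 0 0 (by simp [xiPow])
  simpa [xiPow, eq_comm] using this

lemma apply_snd_lt (hu : IsFixedPoint k u) (hk : 2 ≤ k) (m : ℕ) : (u m).2 < k := by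
  apply lt_of_mem_xiPow hk m
  rw [hu.xiPow_eq m]
  exact List.mem_map.2 ⟨m, List.mem_range.2 (lt_length_xiPow k m), rfl⟩

lemma apply_imagePos_add_one_snd (hu : IsFixedPoint k u) (m : ℕ) :
    (u (imagePos k u m + 1)).2 = 1 ↔ (u m).2 = 0 := by
  constructor
  · intro h
    by_contra h0
    rw [← imagePos_succ_of_ne_zero h0, hu.apply_imagePos] at h
    exact xiHead_snd_ne_one _ _ h
  · intro h
    rw [hu.apply_imagePos_add_one h]

/-- Every letter `j + 1` is preceded by the letter `j`. -/
lemma pred_of_apply (hu : IsFixedPoint k u) (j : ℕ) :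
    ∀ (m : ℕ) (b : Bool), u m = (b, j + 1) → ∃ m', m = m' + 1 ∧ u m' = (b, j) := by
  induction j with
  | zero =>
    intro m b h
    obtain ⟨m', rfl | ⟨h0, rfl⟩⟩ := exists_imagePos k u m
    · exact absurd (by rw [← hu.apply_imagePos, h]) (xiHead_snd_ne_one k (u m'))
    · refine ⟨_, rfl, ?_⟩
      rw [hu.apply_imagePos_add_one h0] at h
      rw [hu.apply_imagePos, xiHead, if_pos h0]
      simp_all [Prod.ext_iff]
  | succ j ih =>
    intro m b h
    obtain ⟨m', rfl | ⟨h0, rfl⟩⟩ := exists_imagePos k u m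
    · have hm' : u m' = (b, j + 1) ∧ j + 1 ≠ k - 1 := by
        rw [hu.apply_imagePos, xiHead] at h
        split_ifs at h <;> simp_all [Prod.ext_iff]
      obtain ⟨m'', rfl, hm''⟩ := ih m' b hm'.1
      by_cases hj : j = 0
      · subst hj
        refine ⟨imagePos k u m'' + 1, imagePos_succ_of_zero (by simp [hm'']), ?_⟩
        rw [hu.apply_imagePos_add_one (by simp [hm'']), hm'']
      · refine ⟨imagePos k u m'', imagePos_succ_of_ne_zero (by simpa [hm''] using hj), ?_⟩
        have hlt : j ≠ k - 1 := by
          have hk' : (u (m'' + 1)).2 < k ∨ k < 2 := by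
            rcases lt_or_ge k 2 with h | h
            · exact Or.inr h
            · exact Or.inl (hu.apply_snd_lt h _)
          rw [hm'.1] at hk'
          simp only at hk'
          omega
        rw [hu.apply_imagePos, hm'', xiHead]
        simp [hj, hlt]
    · rw [hu.apply_imagePos_add_one h0] at h
      simp [Prod.ext_iff] at h

lemma prefixOccurs_image (hu : IsFixedPoint k u) {t : Bool} {m M : ℕ}
    (h : PrefixOccurs u t m M) :
    imagePos k u (m + M) = imagePos k u m + imagePos k u M ∧
      PrefixOccurs u t (imagePos k u m) (imagePos k u M) := by
  induction M with
  | zero => exact ⟨rfl, fun i hi => absurd hi (Nat.not_lt_zero i)⟩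
  | succ M ih =>
    obtain ⟨hpos, hocc⟩ := ih (fun i hi => h i (by omega))
    have hM := h M (by omega)
    have hhead : u (imagePos k u m + imagePos k u M) =
        (xor t (u (imagePos k u M)).1, (u (imagePos k u M)).2) := by
      rw [← hpos, hu.apply_imagePos, hu.apply_imagePos, hM, xiHead_twist]
    by_cases h0 : (u M).2 = 0
    · have h0' : (u (m + M)).2 = 0 := by rw [hM]; exact h0
      refine ⟨by rw [← Nat.add_assoc, imagePos_succ_of_zero h0', imagePos_succ_of_zero h0, hpos,
        Nat.add_assoc], fun i hi => ?_⟩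
      rw [imagePos_succ_of_zero h0] at hi
      rcases (by omega : i < imagePos k u M ∨ i = imagePos k u M ∨ i = imagePos k u M + 1) with
        hi | rfl | rfl
      · exact hocc i hi
      · exact hhead
      · rw [← Nat.add_assoc, ← hpos, hu.apply_imagePos_add_one h0',
          hu.apply_imagePos_add_one h0, hM]
    · have h0' : (u (m + M)).2 ≠ 0 := by rw [hM]; exact h0
      refine ⟨by rw [← Nat.add_assoc, imagePos_succ_of_ne_zero h0', imagePos_succ_of_ne_zero h0,
        hpos, Nat.add_assoc], fun i hi => ?_⟩
      rw [imagePos_succ_of_ne_zero h0] at hi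
      rcases (by omega : i < imagePos k u M ∨ i = imagePos k u M) with hi | rfl
      · exact hocc i hi
      · exact hhead

/-- Desubstitution of an occurrence of the image of a prefix of `u`. -/
lemma exists_preimage (hu : IsFixedPoint k u) {q M : ℕ}
    (h : PrefixOccurs u false q (imagePos k u (M + 1)))
    (hlast : (u (q + imagePos k u (M + 1))).2 = 1 → (u M).2 ≠ k - 1) :
    ∃ m, imagePos k u m = q ∧ PrefixOccurs u false m (M + 1) := by
  have hmono := imagePos_strictMono k u
  have heq : ∀ i < imagePos k u (M + 1), u (q + i) = u i := fun i hi => by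
    rw [h i hi, Bool.false_xor]
  obtain ⟨m, rfl | ⟨h0, rfl⟩⟩ := exists_imagePos k u q
  · refine ⟨m, rfl, ?_⟩
    intro i
    induction i using Nat.strong_induction_on with
    | _ i ih =>
    intro hi
    have hpos := (hu.prefixOccurs_image (t := false) (m := m) (M := i)
      (fun i' hi' => ih i' hi' (by omega))).1
    have hhead : xiHead k (u (m + i)) = xiHead k (u i) := by
      rw [← hu.apply_imagePos, hpos, heq _ (hmono hi), hu.apply_imagePos]
    rw [Bool.false_xor]
    by_cases hin : imagePos k u i + 1 < imagePos k u (M + 1)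
    · refine eq_of_xiHead_eq ?_ hhead
      rw [← hu.apply_imagePos_add_one_snd, hpos, Nat.add_assoc, heq _ hin,
        hu.apply_imagePos_add_one_snd]
    · have hle : imagePos k u (i + 1) ≤ imagePos k u (M + 1) := hmono.monotone (by omega)
      have hi0 : (u i).2 ≠ 0 := fun h0 => by
        rw [imagePos_succ_of_zero h0] at hle
        omega
      rw [imagePos_succ_of_ne_zero hi0] at hle
      have hend : imagePos k u (M + 1) = imagePos k u (i + 1) := by
        rw [imagePos_succ_of_ne_zero hi0]
        omega
      obtain rfl : M = i := by
        have := hmono.injective hend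
        omega
      refine eq_of_xiHead_eq ?_ hhead
      refine iff_of_false (fun h0 => ?_) hi0
      have h1 := (hu.apply_imagePos_add_one_snd (m + M)).2 h0
      rw [hpos, Nat.add_assoc, ← imagePos_succ_of_ne_zero hi0] at h1
      have hk1 := hlast h1
      have := congrArg Prod.snd hhead
      simp [xiHead, h0, hi0, hk1] at this
  · have := heq 0 ((Nat.zero_le _).trans_lt (hmono (Nat.succ_pos M)))
    rw [Nat.add_zero, hu.apply_imagePos_add_one h0, hu.apply_zero] at this
    simp [Prod.ext_iff] at this

lemma apply_of_lt (hu : IsFixedPoint k u) (i : ℕ) (hi : i < k) :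
    u i = (false, i) ∧ imagePos k u (i + 1) = i + 2 := by
  induction i with
  | zero =>
    have h0 := hu.apply_zero
    exact ⟨h0, by rw [imagePos_succ_of_zero (by simp [h0])]; rfl⟩
  | succ i ih =>
    obtain ⟨h1, h2⟩ := ih (by omega)
    have h3 : u (i + 1) = (false, i + 1) := by
      rcases i with - | i
      · have := hu.apply_imagePos_add_one (m := 0) (by simp [h1])
        simpa [imagePos, h1] using this
      · have h4 := imagePos_succ_of_ne_zero (k := k) (u := u) (m := i + 1) (by simp [h1])
        have h5 := hu.apply_imagePos (i + 1)
        rw [(by omega : imagePos k u (i + 1) = i + 1 + 1), h1] at h5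
        rw [h5, xiHead]
        simp
        omega
    exact ⟨h3, by rw [imagePos_succ_of_ne_zero (by simp [h3]), h2]⟩

lemma imagePos_self (hu : IsFixedPoint k u) (hk : 2 ≤ k) : imagePos k u k = k + 1 := by
  have := (hu.apply_of_lt (k - 1) (by omega)).2
  rw [Nat.sub_add_cancel (by omega)] at this
  omega

lemma apply_self (hu : IsFixedPoint k u) (hk : 3 ≤ k) : u k = (true, 0) := by
  have h1 := (hu.apply_of_lt (k - 2) (by omega)).2
  have h2 := hu.apply_imagePos (k - 1)
  rw [(by omega : k - 2 + 1 = k - 1)] at h1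
  rw [h1, (hu.apply_of_lt (k - 1) (by omega)).1, (by omega : k - 2 + 2 = k)] at h2
  rw [h2, xiHead]
  simp
  omega

lemma apply_self_add_one (hu : IsFixedPoint k u) (hk : 3 ≤ k) : u (k + 1) = (true, 0) := by
  rw [← hu.imagePos_self (by omega), hu.apply_imagePos, hu.apply_self hk]
  rfl

lemma imagePos_self_add_one (hu : IsFixedPoint k u) (hk : 3 ≤ k) :
    imagePos k u (k + 1) = k + 3 := by
  rw [imagePos_succ_of_zero (by rw [hu.apply_self hk]), hu.imagePos_self (by omega)]

lemma length_xiPow_of_le (hu : IsFixedPoint k u) (n : ℕ) (hn : n ≤ k) :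
    (xiPow k n).length = n + 1 := by
  induction n with
  | zero => rfl
  | succ n ih =>
    rw [hu.length_xiPow_succ, ih (by omega), (hu.apply_of_lt n (by omega)).2]

lemma occursAt_xiPow_iff (hu : IsFixedPoint k u) (n j : ℕ) :
    OccursAt (xiPow k n) u j ↔ PrefixOccurs u false j (xiPow k n).length := by
  refine forall₂_congr fun i hi => ?_
  have := hu n i hi
  rw [Nat.zero_add] at this
  rw [this]
  simp [eq_comm]

/-- For `n > k`, the word `ξ^n(0)` without its last letter extends to the right uniquely. -/
lemma prefixOccurs_of_pred (hu : IsFixedPoint k u) (hk : 3 ≤ k) (n : ℕ) (hn : k + 1 ≤ n) :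
    ∀ q, PrefixOccurs u false q ((xiPow k n).length - 1) →
      PrefixOccurs u false q (xiPow k n).length := by
  induction n, hn using Nat.le_induction with
  | base =>
    intro q h
    rw [hu.length_xiPow_succ, hu.length_xiPow_of_le k le_rfl,
      hu.imagePos_self_add_one hk] at h ⊢
    have hkk : imagePos k u (k - 1 + 1) = k + 1 := by
      rw [Nat.sub_add_cancel (by omega), hu.imagePos_self (by omega)]
    have hq : u (q + (k + 1)) = (true, 0) := by
      rw [h (k + 1) (by omega), hu.apply_self_add_one hk]
      rfl
    obtain ⟨m, rfl, hm⟩ := hu.exists_preimage (q := q) (M := k - 1)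
      (fun i hi => h i (by omega)) (fun h1 => by simp [hkk, hq] at h1)
    have hpos := (hu.prefixOccurs_image hm).1
    have hlast := hm (k - 1) (by omega)
    rw [(hu.apply_of_lt (k - 1) (by omega)).1] at hlast
    rw [hkk, Nat.sub_add_cancel (by omega)] at hpos
    rw [Nat.sub_add_cancel (by omega)] at hm
    have hmk : u (m + k) = (true, 0) := by
      rw [← hpos, hu.apply_imagePos] at hq
      by_cases h0 : (u (m + k)).2 = 0
      · rwa [xiHead, if_pos h0] at hq
      · rw [xiHead, if_neg h0] at hq
        split_ifs at hq with h1
        swap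
        · simp at hq
        obtain ⟨m', hm', hu'⟩ := hu.pred_of_apply (k - 2) (m + k) (u (m + k)).1
          (Prod.ext rfl (by simp only; omega))
        rw [(by omega : m' = m + (k - 1)), hlast] at hu'
        simp only [Prod.mk.injEq] at hu'
        omega
    rw [← hu.imagePos_self_add_one hk]
    refine (hu.prefixOccurs_image fun i hi => ?_).2
    rcases (by omega : i < k ∨ i = k) with hi | rfl
    · exact hm i hi
    · rw [hmk, hu.apply_self hk]
      rfl
  | succ n hn ih =>
    intro q h
    obtain ⟨M, hM⟩ : ∃ M, (xiPow k n).length = M + 1 + 1 :=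
      ⟨(xiPow k n).length - 2, by have := lt_length_xiPow k n; omega⟩
    rw [hM] at ih
    rw [hu.length_xiPow_succ, hM] at h ⊢
    suffices ∃ m, imagePos k u m = q ∧ PrefixOccurs u false m (M + 1) by
      obtain ⟨m, rfl, hm⟩ := this
      exact (hu.prefixOccurs_image (ih m hm)).2
    by_cases h0 : (u (M + 1)).2 = 0
    · rw [imagePos_succ_of_zero h0] at h
      refine hu.exists_preimage (fun i hi => h i (by omega)) fun h1 => ?_
      rw [h _ (by omega), hu.apply_imagePos] at h1
      exact absurd h1 (xiHead_snd_ne_one _ _)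
    · rw [imagePos_succ_of_ne_zero h0] at h
      refine hu.exists_preimage (fun i hi => h i (by omega)) fun _ => ?_
      obtain ⟨m', hm', hu'⟩ := hu.pred_of_apply ((u (M + 1)).2 - 1) (M + 1) (u (M + 1)).1
        (Prod.ext rfl (by simp only; omega))
      have hlt := hu.apply_snd_lt (by omega) (M + 1)
      obtain rfl : M = m' := by omega
      rw [hu']
      simp only
      omega

lemma exists_preimage_xiPow (hu : IsFixedPoint k u) (hk : 3 ≤ k) {n q : ℕ} (hn : k ≤ n)
    (h : PrefixOccurs u false q (xiPow k (n + 1)).length) :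
    ∃ m, imagePos k u m = q ∧ PrefixOccurs u false m (xiPow k n).length := by
  rw [hu.length_xiPow_succ] at h
  rcases hn.eq_or_lt with rfl | hn
  · rw [hu.length_xiPow_of_le k le_rfl] at h ⊢
    refine hu.exists_preimage h fun _ => ?_
    rw [hu.apply_self hk]
    simp only
    omega
  · obtain ⟨M, hM⟩ : ∃ M, (xiPow k n).length = M + 1 + 1 :=
      ⟨(xiPow k n).length - 2, by have := lt_length_xiPow k n; omega⟩
    have hlt := imagePos_strictMono k u (Nat.lt_succ_self (M + 1))
    rw [hM] at h
    obtain ⟨m, rfl, hm⟩ := hu.exists_preimage (q := q) (M := M)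
      (fun i hi => h i (hi.trans hlt)) fun h1 => by
        rw [h _ hlt, hu.apply_imagePos] at h1
        exact absurd h1 (xiHead_snd_ne_one _ _)
    exact ⟨m, rfl, hu.prefixOccurs_of_pred hk n hn m (by rwa [hM])⟩

/-- Two occurrences of `ξ^n(0)` in `u` do not overlap. -/
lemma length_xiPow_add_le (hu : IsFixedPoint k u) (hk : 3 ≤ k) (n : ℕ) :
    ∀ j l, j < l → PrefixOccurs u false j (xiPow k n).length →
      PrefixOccurs u false l (xiPow k n).length → j + (xiPow k n).length ≤ l := by
  have small : ∀ n ≤ k, ∀ j l, j < l → PrefixOccurs u false j (xiPow k n).length →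
      PrefixOccurs u false l (xiPow k n).length → j + (xiPow k n).length ≤ l := by
    intro n hn j l hjl hj hl
    rw [hu.length_xiPow_of_le n hn] at hj hl ⊢
    by_contra! hlt
    have h1 := hj (l - j) (by omega)
    have h2 := hl 0 (by omega)
    rw [Nat.add_sub_cancel' hjl.le] at h1
    rw [Nat.add_zero, h1, Bool.false_xor, Bool.false_xor, hu.apply_zero] at h2
    rcases (by omega : l - j < k ∨ l - j = k) with h | h
    · rw [(hu.apply_of_lt _ h).1] at h2
      simp only [Prod.mk.injEq] at h2
      omega
    · rw [h, hu.apply_self hk] at h2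
      simp at h2
  rcases le_total n k with hn | hn
  · exact small n hn
  induction n, hn using Nat.le_induction with
  | base => exact small k le_rfl
  | succ n hn ih =>
    intro j l hjl hj hl
    obtain ⟨j, rfl, hj'⟩ := hu.exists_preimage_xiPow hk hn hj
    obtain ⟨l, rfl, hl'⟩ := hu.exists_preimage_xiPow hk hn hl
    have hmono := imagePos_strictMono k u
    rw [hu.length_xiPow_succ, ← (hu.prefixOccurs_image hj').1]
    exact hmono.monotone (ih j l (hmono.lt_iff_lt.1 hjl) hj' hl')

lemma exists_twin_occurrence (hu : IsFixedPoint k u) (hk : 3 ≤ k) (n : ℕ) :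
    ∃ q, PrefixOccurs u true q (xiPow k n).length := by
  induction n with
  | zero =>
    refine ⟨k, fun i hi => ?_⟩
    obtain rfl : i = 0 := by simpa [xiPow] using hi
    rw [Nat.add_zero, hu.apply_self hk, hu.apply_zero]
    rfl
  | succ n ih =>
    obtain ⟨q, hq⟩ := ih
    exact ⟨_, hu.length_xiPow_succ n ▸ (hu.prefixOccurs_image hq).2⟩

/-- The square of `ξ^n(0)` is a factor of `u`. -/
lemma exists_square (hu : IsFixedPoint k u) (hk : 3 ≤ k) (n : ℕ) :
    ∃ q, PrefixOccurs u false q (xiPow k n).length ∧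
      PrefixOccurs u false (q + (xiPow k n).length) (xiPow k n).length := by
  induction n with
  | zero =>
    obtain ⟨q, hq⟩ := hu.exists_twin_occurrence hk (k + 1)
    rw [hu.length_xiPow_succ, hu.length_xiPow_of_le k le_rfl,
      hu.imagePos_self_add_one hk] at hq
    have h0 := hq k (by omega)
    have h1 := hq (k + 1) (by omega)
    rw [hu.apply_self hk] at h0
    rw [hu.apply_self_add_one hk] at h1
    refine ⟨q + k, fun i hi => ?_, fun i hi => ?_⟩
    all_goals
      obtain rfl : i = 0 := by simpa [xiPow] using hi
      rw [hu.apply_zero]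
    · exact h0
    · exact h1
  | succ n ih =>
    obtain ⟨q, hq, hq'⟩ := ih
    have h := hu.prefixOccurs_image hq
    have h' := (hu.prefixOccurs_image hq').2
    rw [h.1] at h'
    rw [hu.length_xiPow_succ]
    exact ⟨_, h.2, h'⟩

end IsFixedPoint

/-- for `k ≥ 4` and every `n`, the word `ξ^n(0)` is a return word to
itself in `u_k`, every return word to `ξ^n(0)` has length at least `|ξ^n(0)|`, and
hence the shortest return word to `ξ^n(0)` is `ξ^n(0)` itself. -/
theorem stmt_7 (k : ℕ) (hk : 4 ≤ k) (u : ℕ → Letter) (hu : IsFixedPoint k u) :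
    ∀ n : ℕ,
      ReturnWordTo (xiPow k n) (xiPow k n) u ∧
      (∀ r : List Letter, ReturnWordTo r (xiPow k n) u → (xiPow k n).length ≤ r.length) ∧
      (∀ r : List Letter, ReturnWordTo r (xiPow k n) u → r.length = (xiPow k n).length →
        r = xiPow k n) := by
  intro n
  have gap : ∀ j l, j < l → OccursAt (xiPow k n) u j → OccursAt (xiPow k n) u l →
      j + (xiPow k n).length ≤ l := fun j l hjl hj hl =>
    hu.length_xiPow_add_le (by omega) n j l hjl ((hu.occursAt_xiPow_iff n j).1 hj)
      ((hu.occursAt_xiPow_iff n l).1 hl)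
  refine ⟨?_, ?_, ?_⟩
  · obtain ⟨q, hq, hq'⟩ := hu.exists_square (by omega) n
    rw [← hu.occursAt_xiPow_iff] at hq hq'
    have hpos := lt_length_xiPow k n
    refine ⟨q, q + (xiPow k n).length, by omega, hq, hq', fun m hm hm' h => ?_, ?_⟩
    · have := gap q m hm hq h
      omega
    · rw [Nat.add_sub_cancel_left]
      exact occursAt_iff.1 hq
  · rintro r ⟨j, l, hjl, hj, hl, -, rfl⟩
    have := gap j l hjl hj hl
    rw [List.length_map, List.length_range]
    omega
  · rintro r ⟨j, l, hjl, hj, hl, -, rfl⟩ hlen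
    rw [List.length_map, List.length_range] at hlen
    rw [hlen]
    exact (occursAt_iff.1 hj).symm
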